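/- Let p, n1, n2, n4 be positive natural numbers, A : ZMod p → Matrix (Fin n1) (Fin n2) ℂ and B : ZMod p → Matrix (Fin n2) (Fin n4) ℂ (families of frontal slices). Define the t-product A ⋆ B : ZMod p → Matrix (Fin n1) (Fin n4) ℂ slice-wise by (A ⋆ B)(s) = ∑_{t ∈ ZMod p} A(t) * B(s − t), and define the slice-wise DFT Â(k) = ∑_{s ∈ ZMod p} exp(−2πI·(k·s)/p) • A(s). Then for every k ∈ ZMod p, the DFT of the t-product satisfies (A ⋆ B)^(k) = Â(k) * B̂(k) (matrix product). -/

import Mathlib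

/-- The DFT kernel `exp(−2πI·(k·s)/p)`, with `k·s` evaluated via integer
representatives. -/
noncomputable def dftKernel (p : ℕ) (k s : ZMod p) : ℂ :=
  Complex.exp (-(2 * Real.pi * Complex.I * ((k.val * s.val : ℕ) : ℂ) / (p : ℂ)))

/-- The t-product of two three-way tensors given by their frontal slices:
blockwise circular convolution of the frontal slices. -/
noncomputable def tProd {p n1 n2 n4 : ℕ} [NeZero p]
    (A : ZMod p → Matrix (Fin n1) (Fin n2) ℂ)
    (B : ZMod p → Matrix (Fin n2) (Fin n4) ℂ) :
    ZMod p → Matrix (Fin n1) (Fin n4) ℂ :=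
  fun s => ∑ t : ZMod p, A t * B (s - t)

/-- The slice-wise DFT of a three-way tensor given by its frontal slices. -/
noncomputable def sliceDFT {p m n : ℕ} [NeZero p]
    (A : ZMod p → Matrix (Fin m) (Fin n) ℂ) (k : ZMod p) :
    Matrix (Fin m) (Fin n) ℂ :=
  ∑ s : ZMod p, dftKernel p k s • A s

theorem dftKernel_eq_stdAddChar (p : ℕ) [NeZero p] (k s : ZMod p) :
    dftKernel p k s = ZMod.stdAddChar (-(k * s)) := by
  have h : -(k * s) = ((-((k.val * s.val : ℕ) : ℤ) : ℤ) : ZMod p) := by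
    push_cast
    simp only [ZMod.natCast_zmod_val]
  rw [h, ZMod.stdAddChar_coe, dftKernel]
  congr 1
  push_cast
  ring

theorem dftKernel_add (p : ℕ) [NeZero p] (k s t : ZMod p) :
    dftKernel p k (s + t) = dftKernel p k s * dftKernel p k t := by
  simp only [dftKernel_eq_stdAddChar, mul_add, neg_add, AddChar.map_add_eq_mul]

/-- The t-product is equivalent to slice-wise matrix multiplication in the
Fourier domain: the slice-wise DFT of `A ⋆ B` at frequency `k` is the matrix
product of the DFTs of `A` and `B` at `k`. -/
theorem sliceDFT_tProd (p n1 n2 n4 : ℕ) [NeZero p]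
    (hn1 : 0 < n1) (hn2 : 0 < n2) (hn4 : 0 < n4)
    (A : ZMod p → Matrix (Fin n1) (Fin n2) ℂ)
    (B : ZMod p → Matrix (Fin n2) (Fin n4) ℂ) (k : ZMod p) :
    sliceDFT (tProd A B) k = sliceDFT A k * sliceDFT B k := by
  simp only [sliceDFT, tProd, Finset.smul_sum]
  rw [Finset.sum_comm, Matrix.sum_mul]
  refine Finset.sum_congr rfl fun t _ => ?_
  rw [Matrix.mul_sum, ← Equiv.sum_comp (Equiv.addLeft t)]
  refine Finset.sum_congr rfl fun s _ => ?_
  simp [dftKernel_add, smul_smul, mul_comm]
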